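/- The subalgebra of U_q(sl_2)-invariant elements of Cl_q(sl_2) is the 2-dimensional algebra spanned by 1 and γ_q, and is isomorphic to the Clifford algebra of the 1-dimensional space ℂγ_q with bilinear form B_q(γ_q,γ_q) = (1+q²)/(4cq); in particular γ_q² = (1+q²)/(4cq) in Cl_q(sl_2). -/

import Mathlib

noncomputable section

open FreeAlgebra

/-- The defining relations of the q-deformed Clifford algebra Cl_q(sl_2):
generators v_2 = ι 0, v_0 = ι 1, v_{-2} = ι 2. -/
inductive ClRel (q c : ℂ) : FreeAlgebra ℂ (Fin 3) → FreeAlgebra ℂ (Fin 3) → Prop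
  | r1 : ClRel q c (ι ℂ 0 * ι ℂ 0) 0
  | r2 : ClRel q c (ι ℂ 2 * ι ℂ 2) 0
  | r3 : ClRel q c (ι ℂ 1 * ι ℂ 0) (-((q ^ 2)⁻¹ • (ι ℂ 0 * ι ℂ 1)))
  | r4 : ClRel q c (ι ℂ 2 * ι ℂ 1) (-((q ^ 2)⁻¹ • (ι ℂ 1 * ι ℂ 2)))
  | r5 : ClRel q c (ι ℂ 1 * ι ℂ 1)
      (((1 - q ^ 4) / q ^ 3) • (ι ℂ 0 * ι ℂ 2) + ((q ^ 2 + 1) / q * c) • 1)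
  | r6 : ClRel q c (ι ℂ 2 * ι ℂ 0)
      (-(ι ℂ 0 * ι ℂ 2) + ((q ^ 2 + 1) / q ^ 2 * c) • 1)

/-- The q-deformed Clifford algebra Cl_q(sl_2). -/
abbrev Clq (q c : ℂ) := RingQuot (ClRel q c)

def cv2 (q c : ℂ) : Clq q c := RingQuot.mkAlgHom ℂ (ClRel q c) (ι ℂ 0)
def cv0 (q c : ℂ) : Clq q c := RingQuot.mkAlgHom ℂ (ClRel q c) (ι ℂ 1)
def cvm2 (q c : ℂ) : Clq q c := RingQuot.mkAlgHom ℂ (ClRel q c) (ι ℂ 2)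

/-- γ_q = -(1/(2c²))(c v_0 + v_2 v_0 v_{-2}). -/
def gammaq (q c : ℂ) : Clq q c :=
  (-(1 / (2 * c ^ 2)) : ℂ) • (c • cv0 q c + cv2 q c * cv0 q c * cvm2 q c)

/-- α_q(E). -/
def aE (q c : ℂ) : Clq q c := -((q / ((1 + q ^ 2) * c)) • (cv2 q c * cv0 q c))
/-- α_q(F). -/
def aF (q c : ℂ) : Clq q c := -((q ^ 2 / ((1 + q ^ 2) * c)) • (cv0 q c * cvm2 q c))
/-- α_q(K). -/
def aK (q c : ℂ) : Clq q c :=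
  ((q ^ 3 - q) / ((1 + q ^ 2) * c)) • (cv2 q c * cvm2 q c) + (q⁻¹ : ℂ) • (1 : Clq q c)
/-- α_q(K⁻¹). -/
def aKi (q c : ℂ) : Clq q c :=
  -(((q ^ 3 - q) / ((1 + q ^ 2) * c)) • (cv2 q c * cvm2 q c)) + q • (1 : Clq q c)

/-- The U_q(sl_2)-action on Cl_q(sl_2) via α_q: x ▷ ω = Σ α_q(x_{(1)}) ω α_q(S(x_{(2)})),
for the generator E (using ΔE = E⊗K + 1⊗E, S(E) = -EK⁻¹, S(K) = K⁻¹). -/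
def actE (q c : ℂ) (ω : Clq q c) : Clq q c :=
  aE q c * ω * aKi q c - ω * (aE q c * aKi q c)

/-- The action of the generator F (using ΔF = F⊗1 + K⁻¹⊗F, S(F) = -KF). -/
def actF (q c : ℂ) (ω : Clq q c) : Clq q c :=
  aF q c * ω - aKi q c * ω * (aK q c * aF q c)

/-- The action of the generator K. -/
def actK (q c : ℂ) (ω : Clq q c) : Clq q c := aK q c * ω * aKi q c

section Abstract

set_option linter.unusedSimpArgs false
set_option linter.unusedSectionVars false

variable {A : Type*} [Ring A] [Algebra ℂ A]

/-- The relations of `Cl_q(sl_2)` for a triple of elements of an algebra. -/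
structure CRel (q c : ℂ) (x y z : A) : Prop where
  xx : x * x = 0
  zz : z * z = 0
  yx : y * x = -((q ^ 2)⁻¹ • (x * y))
  zy : z * y = -((q ^ 2)⁻¹ • (y * z))
  yy : y * y = ((1 - q ^ 4) / q ^ 3) • (x * z) + ((q ^ 2 + 1) / q * c) • (1 : A)
  zx : z * x = -(x * z) + ((q ^ 2 + 1) / q ^ 2 * c) • (1 : A)

namespace CRel

variable {q c : ℂ} {x y z : A} (h : CRel q c x y z)

theorem xx' (h : CRel q c x y z) (w : A) : x * (x * w) = 0 := by
  rw [← mul_assoc, h.xx, zero_mul]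
theorem zz' (h : CRel q c x y z) (w : A) : z * (z * w) = 0 := by
  rw [← mul_assoc, h.zz, zero_mul]
theorem yx' (h : CRel q c x y z) (w : A) : y * (x * w) = -((q ^ 2)⁻¹ • (x * (y * w))) := by
  rw [← mul_assoc, h.yx, neg_mul, smul_mul_assoc, mul_assoc]
theorem zy' (h : CRel q c x y z) (w : A) : z * (y * w) = -((q ^ 2)⁻¹ • (y * (z * w))) := by
  rw [← mul_assoc, h.zy, neg_mul, smul_mul_assoc, mul_assoc]
theorem yy' (h : CRel q c x y z) (w : A) :
    y * (y * w) = ((1 - q ^ 4) / q ^ 3) • (x * (z * w)) + ((q ^ 2 + 1) / q * c) • w := by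
  rw [← mul_assoc, h.yy, add_mul, smul_mul_assoc, smul_mul_assoc, mul_assoc, one_mul]
theorem zx' (h : CRel q c x y z) (w : A) :
    z * (x * w) = -(x * (z * w)) + ((q ^ 2 + 1) / q ^ 2 * c) • w := by
  rw [← mul_assoc, h.zx, add_mul, neg_mul, smul_mul_assoc, mul_assoc, one_mul]

theorem neg (h : CRel q c x y z) : CRel q c (-x) (-y) (-z) := by
  constructor <;> simp only [neg_mul_neg]
  exacts [h.xx, h.zz, h.yx, h.zy, h.yy, h.zx]

end CRel

theorem commute_neg_abs (u w : A) : Commute (-u) w ↔ Commute u w := Commute.neg_left_iff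

theorem gamma_neg_abs (r c : ℂ) (x y z : A) :
    r • (c • -y + -x * -y * -z) = -(r • (c • y + x * y * z)) := by
  rw [neg_mul_neg, mul_neg]
  module

/-- Normal form. -/
def nf (x y z : A) (a : Fin 8 → ℂ) : A :=
  a 0 • 1 + a 1 • y + a 2 • (x * z) + a 3 • (x * (y * z)) + a 4 • x + a 5 • (x * y)
    + a 6 • z + a 7 • (y * z)

theorem nf_x {q c : ℂ} {x y z : A} (h : CRel q c x y z) (a : Fin 8 → ℂ) :
    ∃ b, x * nf x y z a = nf x y z b := by
  refine ⟨![0, 0, a 6, a 7, a 0, a 1, 0, 0], ?_⟩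
  simp [nf, mul_add, h.xx, h.xx']
  module

theorem nf_y {q c : ℂ} {x y z : A} (h : CRel q c x y z) (a : Fin 8 → ℂ) :
    ∃ b, y * nf x y z a = nf x y z b := by
  refine ⟨![a 1 * ((q ^ 2 + 1) / q * c), a 0,
    a 1 * ((1 - q ^ 4) / q ^ 3) - (q ^ 2)⁻¹ * a 3 * ((q ^ 2 + 1) / q * c),
    -(q ^ 2)⁻¹ * a 2, -(q ^ 2)⁻¹ * a 5 * ((q ^ 2 + 1) / q * c), -(q ^ 2)⁻¹ * a 4,
    a 7 * ((q ^ 2 + 1) / q * c), a 6], ?_⟩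
  simp [nf, mul_add, h.yx, h.yx', h.yy, h.yy', h.xx, h.xx', h.zz, h.zz']
  module

theorem nf_z {q c : ℂ} {x y z : A} (h : CRel q c x y z) (a : Fin 8 → ℂ) :
    ∃ b, z * nf x y z a = nf x y z b := by
  refine ⟨![a 4 * ((q ^ 2 + 1) / q ^ 2 * c), a 5 * ((q ^ 2 + 1) / q ^ 2 * c),
    - a 4, (q ^ 2)⁻¹ * a 5, 0, 0, a 0 + a 2 * ((q ^ 2 + 1) / q ^ 2 * c),
    -(q ^ 2)⁻¹ * a 1 + a 3 * ((q ^ 2 + 1) / q ^ 2 * c)], ?_⟩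
  simp [nf, mul_add, h.zx, h.zx', h.zy, h.zy', h.xx, h.xx', h.zz, h.zz']
  module

theorem gamma_sq_abs {q c : ℂ} {x y z : A} (h : CRel q c x y z) (hq : q ≠ 0) (hc : c ≠ 0) :
    ((-(1 / (2 * c ^ 2)) : ℂ) • (c • y + x * y * z)) *
      ((-(1 / (2 * c ^ 2)) : ℂ) • (c • y + x * y * z)) =
      ((1 + q ^ 2) / (4 * c * q)) • (1 : A) := by
  simp [mul_add, add_mul, mul_assoc, h.zx, h.zx', h.zy, h.zy', h.xx, h.xx', h.zz, h.zz',
    h.yx, h.yx', h.yy, h.yy']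
  match_scalars <;> field_simp <;> ring

/-- The element `gamma` commutes with the `x z`, `x y`, `y z`. -/
theorem comm_abs {q c : ℂ} {x y z : A} (h : CRel q c x y z) (hq : q ≠ 0) :
    Commute (x * z) (c • y + x * y * z) ∧ Commute (x * y) (c • y + x * y * z) ∧
    Commute (y * z) (c • y + x * y * z) := by
  refine ⟨?_, ?_, ?_⟩ <;> unfold Commute SemiconjBy <;>
  simp [mul_add, add_mul, mul_assoc, h.zx, h.zx', h.zy, h.zy', h.xx, h.xx', h.zz, h.zz',
    h.yx, h.yx', h.yy, h.yy'] <;>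
  match_scalars <;> field_simp <;> ring

theorem centr_abs {q c : ℂ} {x y z : A} (h : CRel q c x y z) (hq : q ≠ 0) (hc : c ≠ 0)
    (h1 : q ^ 2 + 1 ≠ 0) (a : Fin 8 → ℂ)
    (hP : Commute (x * z) (nf x y z a)) (hE : Commute (x * y) (nf x y z a)) :
    nf x y z a = a 0 • 1 + (a 1 / c) • (c • y + x * y * z) := by
  have hD : (q ^ 2 + 1) / q ^ 2 * c ≠ 0 := by positivity
  have hB : (q ^ 2 + 1) / q * c ≠ 0 := by positivity
  have hP' := hP.eq
  have e1 : a 4 • x + a 5 • (x * y) = 0 := by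
    have : (x * z) * (x * z * nf x y z a) = (x * z) * (nf x y z a * (x * z)) := by rw [hP']
    rw [← sub_eq_zero] at this
    rw [← smul_eq_zero_iff_right (mul_ne_zero hD hD), ← this]
    simp [nf, mul_add, add_mul, mul_assoc, h.zx, h.zx', h.zy, h.zy', h.xx, h.xx', h.zz, h.zz',
      h.yx, h.yx', h.yy, h.yy']
    match_scalars <;> field_simp <;> ring
  have e2 : a 6 • z + a 7 • (y * z) = 0 := by
    have : (x * z * nf x y z a) * (x * z) = (nf x y z a * (x * z)) * (x * z) := by rw [hP']
    rw [← sub_eq_zero] at this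
    rw [← smul_eq_zero_iff_right (neg_ne_zero.2 (mul_ne_zero hD hD)), ← this]
    simp [nf, mul_add, add_mul, mul_assoc, h.zx, h.zx', h.zy, h.zy', h.xx, h.xx', h.zz, h.zz',
      h.yx, h.yx', h.yy, h.yy']
    match_scalars <;> field_simp <;> ring
  have e0 : nf x y z a = a 0 • 1 + a 1 • y + a 2 • (x * z) + a 3 • (x * (y * z)) := by
    have : nf x y z a = a 0 • 1 + a 1 • y + a 2 • (x * z) + a 3 • (x * (y * z))
      + (a 4 • x + a 5 • (x * y)) + (a 6 • z + a 7 • (y * z)) := by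
      unfold nf; abel
    rw [this, e1, e2]; simp
  rw [e0] at hE ⊢
  have e3 : a 2 • (x * z) + (a 3 - a 1 / c) • (x * (y * z)) = 0 := by
    have := sub_eq_zero.2 hE.eq
    have h2 := congrArg (fun t => t * (y * z)) this
    simp only [zero_mul] at h2
    rw [← smul_eq_zero_iff_right (neg_ne_zero.2 (mul_ne_zero hD hB)), ← h2]
    simp [mul_add, add_mul, sub_mul, mul_assoc, h.zx, h.zx', h.zy, h.zy', h.xx, h.xx', h.zz,
      h.zz', h.yx, h.yx', h.yy, h.yy']
    match_scalars <;> field_simp <;> ring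
  rw [← sub_eq_zero, ← e3]
  simp only [mul_assoc]
  match_scalars <;> field_simp <;> ring

/-- Invariance in abstract form: commuting with `K`, `E`. -/
theorem inv_abs {k ki e f w : A} (h1 : k * ki = 1) (h2 : ki * k = 1) :
    (e * w * ki - w * (e * ki) = 0 ∧ f * w - ki * w * (k * f) = 0 ∧ k * w * ki = w) ↔
    (Commute k w ∧ Commute e w ∧ Commute f w) := by
  have hk : k * w * ki = w ↔ k * w = w * k := by
    constructor
    · intro h
      calc k * w = k * w * (ki * k) := by rw [h2, mul_one]
        _ = (k * w * ki) * k := by noncomm_ring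
        _ = _ := by rw [h]
    · intro h
      rw [h, mul_assoc, h1, mul_one]
  have he : e * w * ki - w * (e * ki) = 0 ↔ e * w = w * e := by
    rw [sub_eq_zero]
    constructor
    · intro h
      calc e * w = (e * w * ki) * k := by rw [mul_assoc, h2, mul_one]
        _ = _ := by rw [h, ← mul_assoc, mul_assoc, h2, mul_one]
    · intro h
      rw [h, mul_assoc]
  have hf : k * w = w * k → (f * w - ki * w * (k * f) = 0 ↔ f * w = w * f) := by
    intro h
    have : ki * w * (k * f) = w * f := by
      calc ki * w * (k * f) = ki * (w * k) * f := by noncomm_ring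
        _ = (ki * k) * w * f := by rw [← h]; noncomm_ring
        _ = _ := by rw [h2, one_mul]
    rw [this, sub_eq_zero]
  unfold Commute SemiconjBy
  rw [hk, he]
  constructor
  · rintro ⟨a, b, d⟩
    exact ⟨d, a, (hf d).1 b⟩
  · rintro ⟨a, b, d⟩
    exact ⟨b, (hf a).2 d, a⟩

theorem K_abs {q c : ℂ} {x y z : A} (h : CRel q c x y z) (hq : q ≠ 0) (hc : c ≠ 0)
    (h1 : q ^ 2 + 1 ≠ 0) :
    (((q ^ 3 - q) / ((1 + q ^ 2) * c)) • (x * z) + (q⁻¹ : ℂ) • (1 : A)) *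
      (-(((q ^ 3 - q) / ((1 + q ^ 2) * c)) • (x * z)) + q • (1 : A)) = 1 ∧
    (-(((q ^ 3 - q) / ((1 + q ^ 2) * c)) • (x * z)) + q • (1 : A)) *
    (((q ^ 3 - q) / ((1 + q ^ 2) * c)) • (x * z) + (q⁻¹ : ℂ) • (1 : A)) = 1 := by
  have h1' : 1 + q ^ 2 ≠ 0 := by rwa [add_comm]
  constructor <;>
  simp [mul_add, add_mul, mul_assoc, h.zx, h.zx', h.xx, h.xx', h.zz, h.zz'] <;>
  match_scalars <;> field_simp <;> ring

end Abstract

theorem clq_rel (q c : ℂ) : CRel q c (cv2 q c) (cv0 q c) (cvm2 q c) := by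
  constructor
  · simpa [cv2] using RingQuot.mkAlgHom_rel ℂ (ClRel.r1 (q := q) (c := c))
  · simpa [cvm2] using RingQuot.mkAlgHom_rel ℂ (ClRel.r2 (q := q) (c := c))
  · simpa [cv2, cv0] using RingQuot.mkAlgHom_rel ℂ (ClRel.r3 (q := q) (c := c))
  · simpa [cvm2, cv0] using RingQuot.mkAlgHom_rel ℂ (ClRel.r4 (q := q) (c := c))
  · simpa [cvm2, cv0, cv2] using RingQuot.mkAlgHom_rel ℂ (ClRel.r5 (q := q) (c := c))
  · simpa [cvm2, cv0, cv2] using RingQuot.mkAlgHom_rel ℂ (ClRel.r6 (q := q) (c := c))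

theorem clq_lift {A : Type} [Ring A] [Algebra ℂ A] {q c : ℂ} {x y z : A}
    (h : CRel q c x y z) : ∃ φ : Clq q c →ₐ[ℂ] A,
      φ (cv2 q c) = x ∧ φ (cv0 q c) = y ∧ φ (cvm2 q c) = z := by
  let F : FreeAlgebra ℂ (Fin 3) →ₐ[ℂ] A := FreeAlgebra.lift ℂ ![x, y, z]
  have hF : ∀ ⦃a b⦄, ClRel q c a b → F a = F b := by
    intro a b hab
    cases hab
    · simpa [F] using h.xx
    · simpa [F] using h.zz
    · simpa [F] using h.yx
    · simpa [F] using h.zy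
    · simpa [F] using h.yy
    · simpa [F] using h.zx
  refine ⟨RingQuot.liftAlgHom ℂ ⟨F, hF⟩, ?_, ?_, ?_⟩ <;> simp [cv2, cv0, cvm2, F]

theorem clq_span (q c : ℂ) (w : Clq q c) :
    ∃ a, w = nf (cv2 q c) (cv0 q c) (cvm2 q c) a := by
  have h := clq_rel q c
  obtain ⟨t, rfl⟩ := RingQuot.mkAlgHom_surjective ℂ (ClRel q c) w
  suffices H : ∀ a, ∃ b, RingQuot.mkAlgHom ℂ (ClRel q c) t *
      nf (cv2 q c) (cv0 q c) (cvm2 q c) a = nf (cv2 q c) (cv0 q c) (cvm2 q c) b by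
    obtain ⟨b, hb⟩ := H ![1, 0, 0, 0, 0, 0, 0, 0]
    refine ⟨b, ?_⟩
    rw [← hb]
    simp [nf]
  induction t using FreeAlgebra.induction with
  | grade0 r =>
    intro a
    refine ⟨r • a, ?_⟩
    simp [nf, Algebra.algebraMap_eq_smul_one]
    module
  | grade1 i =>
    intro a
    fin_cases i
    · exact nf_x h a
    · exact nf_y h a
    · exact nf_z h a
  | mul s t hs ht =>
    intro a
    obtain ⟨b, hb⟩ := ht a
    obtain ⟨d, hd⟩ := hs b
    exact ⟨d, by rw [map_mul, mul_assoc, hb, hd]⟩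
  | add s t hs ht =>
    intro a
    obtain ⟨b, hb⟩ := ht a
    obtain ⟨d, hd⟩ := hs a
    refine ⟨b + d, ?_⟩
    rw [map_add, add_mul, hb, hd]
    simp [nf]
    module

theorem clq_nontrivial (q c : ℂ) (hq : q ≠ 0) : Nontrivial (Clq q c) := by
  obtain ⟨s, hs⟩ := IsAlgClosed.exists_pow_nat_eq ((q ^ 2 + 1) / q * c) (n := 2) (by norm_num)
  have h : CRel q c (!![0, 1; 0, 0] : Matrix (Fin 2) (Fin 2) ℂ)
      !![-(q ^ 2)⁻¹ * s, 0; 0, s] !![0, 0; (q ^ 2 + 1) / q ^ 2 * c, 0] := by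
    constructor <;> ext i j <;> fin_cases i <;> fin_cases j <;> simp
    · ring
    · rw [show (q ^ 2)⁻¹ * s * ((q ^ 2)⁻¹ * s) = (q ^ 2)⁻¹ * (q ^ 2)⁻¹ * s ^ 2 by ring, hs]
      field_simp
      ring
    · rw [← sq, hs]
  obtain ⟨φ, -⟩ := clq_lift h
  exact φ.toRingHom.domain_nontrivial

theorem gamma_indep (q c : ℂ) (hq : q ≠ 0) (hc : c ≠ 0)
    (hlam : (1 + q ^ 2) / (4 * c * q) ≠ 0) (a b : ℂ)
    (hab : a • (1 : Clq q c) + b • gammaq q c = 0) : a = 0 ∧ b = 0 := by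
  have := clq_nontrivial q c hq
  have h := clq_rel q c
  have h' : CRel q c (-cv2 q c) (-cv0 q c) (-cvm2 q c) := by
    exact h.neg
  obtain ⟨φ, h1, h2, h3⟩ := clq_lift h'
  have hg : φ (gammaq q c) = - gammaq q c := by
    rw [gammaq, map_smul, map_add, map_smul, map_mul, map_mul, h1, h2, h3]
    exact gamma_neg_abs _ _ _ _ _
  have h4 := congrArg φ hab
  simp only [map_add, map_smul, map_one, hg, map_zero] at h4
  have ha : a = 0 := by
    have : (2 * a) • (1 : Clq q c) = 0 := by
      calc _ = (a • (1 : Clq q c) + b • gammaq q c) + (a • 1 + b • -gammaq q c) := by module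
        _ = 0 := by rw [hab, h4, add_zero]
    simpa using this
  refine ⟨ha, ?_⟩
  subst ha
  by_contra hb
  have hg0 : gammaq q c = 0 := by simpa [hb] using hab
  have hsq : gammaq q c * gammaq q c = ((1 + q ^ 2) / (4 * c * q)) • (1 : Clq q c) :=
    gamma_sq_abs h hq hc
  rw [hg0, zero_mul] at hsq
  exact (smul_ne_zero hlam one_ne_zero) hsq.symm

theorem invariants_aux (q c : ℂ) (hq : q ≠ 0) (hc : c ≠ 0) (h1 : q ^ 2 + 1 ≠ 0)
    (h2 : q ^ 2 ≠ 1) (w : Clq q c) :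
    (actE q c w = 0 ∧ actF q c w = 0 ∧ actK q c w = w) ↔
    (Commute (cv2 q c * cvm2 q c) w ∧ Commute (cv2 q c * cv0 q c) w ∧
      Commute (cv0 q c * cvm2 q c) w) := by
  have h1' : 1 + q ^ 2 ≠ 0 := by rwa [add_comm]
  have h := clq_rel q c
  obtain ⟨k1, k2⟩ := K_abs h hq hc h1
  have := inv_abs (e := aE q c) (f := aF q c) (w := w) k1 k2
  refine this.trans ?_
  have hs : ∀ (r : ℂ), r ≠ 0 → ∀ u : Clq q c, Commute (r • u) w ↔ Commute u w := by
    intro r hr u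
    constructor
    · intro hu
      have := hu.smul_left r⁻¹
      rwa [smul_smul, inv_mul_cancel₀ hr, one_smul] at this
    · intro hu
      exact hu.smul_left r
  have hqq : q ^ 3 - q ≠ 0 := by
    intro h0
    have : q * (q ^ 2 - 1) = 0 := by rw [← h0]; ring
    rcases mul_eq_zero.1 this with h5 | h5
    · exact hq h5
    · exact h2 (sub_eq_zero.1 h5)
  have hone : Commute ((q⁻¹ : ℂ) • (1 : Clq q c)) w := (Commute.one_left w).smul_left _
  refine and_congr ?_ (and_congr ?_ ?_)
  · rw [← hs _ (div_ne_zero hqq (mul_ne_zero h1' hc)) (cv2 q c * cvm2 q c)]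
    constructor
    · intro hu
      have := hu.sub_left hone
      rwa [add_sub_cancel_right] at this
    · intro hu
      exact hu.add_left hone
  · refine (commute_neg_abs _ _).trans ?_
    exact hs _ (div_ne_zero hq (mul_ne_zero h1' hc)) _
  · refine (commute_neg_abs _ _).trans ?_
    exact hs _ (div_ne_zero (pow_ne_zero 2 hq) (mul_ne_zero h1' hc)) _

theorem cliff_form (lam : ℂ) (t : CliffordAlgebra (lam • (QuadraticMap.sq (R := ℂ)))) :
    ∃ a b : ℂ, t = a • 1 + b • CliffordAlgebra.ι (lam • (QuadraticMap.sq (R := ℂ))) 1 := by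
  induction t using CliffordAlgebra.induction with
  | algebraMap r => exact ⟨r, 0, by simp [Algebra.algebraMap_eq_smul_one]⟩
  | ι x => exact ⟨0, x, by rw [← map_smul]; simp⟩
  | mul s t hs ht =>
    obtain ⟨a, b, rfl⟩ := hs
    obtain ⟨a', b', rfl⟩ := ht
    refine ⟨a * a' + b * b' * lam, a * b' + b * a', ?_⟩
    simp [mul_add, add_mul, Algebra.algebraMap_eq_smul_one]
    module
  | add s t hs ht =>
    obtain ⟨a, b, rfl⟩ := hs
    obtain ⟨a', b', rfl⟩ := ht
    exact ⟨a + a', b + b', by module⟩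

theorem cliff_equiv {A : Type} [Ring A] [Algebra ℂ A] (g : A) (lam : ℂ)
    (hsq : g * g = lam • (1 : A))
    (hind : ∀ a b : ℂ, a • (1 : A) + b • g = 0 → a = 0 ∧ b = 0) :
    Nonempty ((Algebra.adjoin ℂ ({g} : Set A)) ≃ₐ[ℂ]
        CliffordAlgebra (lam • (QuadraticMap.sq (R := ℂ)))) := by
  let f : ℂ →ₗ[ℂ] A := LinearMap.toSpanSingleton ℂ _ (g)
  have hf : ∀ m, f m * f m = algebraMap ℂ _
      ((lam • (QuadraticMap.sq (R := ℂ))) m) := by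
    intro m
    simp only [f, LinearMap.toSpanSingleton_apply, smul_mul_smul_comm, hsq,
      Algebra.algebraMap_eq_smul_one, smul_apply, QuadraticMap.sq_apply,
      smul_eq_mul]
    module
  let φ := CliffordAlgebra.lift (lam • (QuadraticMap.sq (R := ℂ)))
    ⟨f, hf⟩
  have hφ1 : φ (CliffordAlgebra.ι _ 1) = g := by
    simp [φ, f]
  have hinj : Function.Injective φ := by
    rw [injective_iff_map_eq_zero]
    intro t ht
    obtain ⟨a, b, rfl⟩ := cliff_form _ t
    rw [map_add, map_smul, map_smul, map_one, hφ1] at ht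
    obtain ⟨rfl, rfl⟩ := hind a b ht
    simp
  have hr : φ.range = Algebra.adjoin ℂ {g} := by
    apply le_antisymm
    · intro u hu
      obtain ⟨t, ht⟩ := (AlgHom.mem_range φ).1 hu
      obtain ⟨a, b, hab⟩ := cliff_form _ t
      have hgm : g ∈ Algebra.adjoin ℂ ({g} : Set A) :=
        Algebra.subset_adjoin (Set.mem_singleton g)
      rw [hab, map_add, map_smul, map_smul, map_one, hφ1] at ht
      rw [← ht]
      exact Subalgebra.add_mem _ (Subalgebra.smul_mem _ (Subalgebra.one_mem _) a)
        (Subalgebra.smul_mem _ hgm b)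
    · rw [Algebra.adjoin_le_iff, Set.singleton_subset_iff]
      exact (AlgHom.mem_range φ).2 ⟨_, hφ1⟩
  rw [← hr]
  exact ⟨(AlgEquiv.ofInjective φ hinj).symm⟩

/-- The subalgebra of U_q(sl_2)-invariant elements of Cl_q(sl_2)
(those ω with E ▷ ω = 0, F ▷ ω = 0, K ▷ ω = ω) is the 2-dimensional algebra spanned
by 1 and γ_q, and is isomorphic to the Clifford algebra of the 1-dimensional space
ℂγ_q with bilinear form B_q(γ_q, γ_q) = (1+q²)/(4cq); in particular
γ_q² = (1+q²)/(4cq) in Cl_q(sl_2). -/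
theorem invariants_are_rank_one_clifford
    (q c : ℂ) (hq : q ≠ 0) (hc : c ≠ 0) (hroot : ∀ n : ℕ, 0 < n → q ^ n ≠ 1)
    (hlam : (1 + q ^ 2) / (4 * c * q) ≠ 0) :
    gammaq q c * gammaq q c = ((1 + q ^ 2) / (4 * c * q)) • (1 : Clq q c) ∧
    {ω : Clq q c | actE q c ω = 0 ∧ actF q c ω = 0 ∧ actK q c ω = ω} =
      (Submodule.span ℂ ({1, gammaq q c} : Set (Clq q c)) : Set (Clq q c)) ∧
    Module.finrank ℂ
      (Submodule.span ℂ ({1, gammaq q c} : Set (Clq q c))) = 2 ∧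
    Nonempty
      ((Algebra.adjoin ℂ ({gammaq q c} : Set (Clq q c))) ≃ₐ[ℂ]
        CliffordAlgebra (((1 + q ^ 2) / (4 * c * q)) • (QuadraticMap.sq (R := ℂ)))) := by
  have h := clq_rel q c
  have h1' : 1 + q ^ 2 ≠ 0 := fun h0 => hlam (by rw [h0, zero_div])
  have h1 : q ^ 2 + 1 ≠ 0 := by rwa [add_comm]
  have h2 : q ^ 2 ≠ 1 := hroot 2 (by norm_num)
  have hsq : gammaq q c * gammaq q c = ((1 + q ^ 2) / (4 * c * q)) • (1 : Clq q c) :=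
    gamma_sq_abs h hq hc
  have hind := gamma_indep q c hq hc hlam
  refine ⟨hsq, ?_, ?_, ?_⟩
  · ext w
    rw [Set.mem_ofPred_eq, invariants_aux q c hq hc h1 h2, SetLike.mem_coe,
      Submodule.mem_span_pair]
    constructor
    · rintro ⟨hP, hE, -⟩
      obtain ⟨a, rfl⟩ := clq_span q c w
      refine ⟨a 0, a 1 / c * (-(2 * c ^ 2)), ?_⟩
      rw [centr_abs h hq hc h1 a hP hE, gammaq]
      match_scalars <;> field_simp
    · rintro ⟨a, b, rfl⟩
      obtain ⟨g1, g2, g3⟩ := comm_abs h hq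
      have key : ∀ u : Clq q c,
          Commute u (c • cv0 q c + cv2 q c * cv0 q c * cvm2 q c) →
          Commute u (a • 1 + b • gammaq q c) := fun u hu =>
        ((Commute.one_right u).smul_right a).add_right ((hu.smul_right _).smul_right b)
      exact ⟨key _ g1, key _ g2, key _ g3⟩
  · have hli : LinearIndependent ℂ ![(1 : Clq q c), gammaq q c] :=
      LinearIndependent.pair_iff.2 hind
    have := finrank_span_eq_card hli
    rw [Matrix.range_cons, Matrix.range_cons, Matrix.range_empty, Set.union_empty,
      Set.singleton_union] at this
    simpa using this
  · exact cliff_equiv _ _ hsq hind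

end
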